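/- arXiv:2506.03432 — 2 statements merged into one kernel-verified Lean document; each statement's English description precedes it below -/
import Mathlib

section
/- First order differential equations for the MOPUC of the weight w(θ) = e^{−ηθ}(sin²(θ/2))^λ: for every n ≥ 3, z(z−1)Φ_n'(z) = [n z − (conj(b)+n)] Φ_n(z) − (conj(b)+n) conj(α_{n−1}) Φ_n*(z) and (1−z)(Φ_n*)'(z) = (b+n) α_{n−1} Φ_n(z) + b Φ_n*(z), as identities of polynomials in z, where b = λ + iη. -/
open Polynomial MeasureTheory

section

lemma IntervalIntegrable.complex_ofReal {f : ℝ → ℝ} {a b : ℝ}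
    (hf : IntervalIntegrable f volume a b) :
    IntervalIntegrable (fun x => (f x : ℂ)) volume a b :=
  ⟨hf.1.ofReal, hf.2.ofReal⟩

/-- The pairing `P ↦ ∫ P(e^{iθ}) e^{-ikθ} w(θ) dθ` over `[0, 2π]`. -/
noncomputable def circlePairing (w : ℝ → ℝ) (hw : IntervalIntegrable w volume 0 (2 * Real.pi))
    (k : ℕ) : ℂ[X] →ₗ[ℂ] ℂ where
  toFun P := ∫ θ in (0:ℝ)..(2*Real.pi), P.eval (Complex.exp ((θ:ℂ) * Complex.I)) *
          Complex.exp (-(k : ℂ) * (θ:ℂ) * Complex.I) * (w θ : ℂ)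
  map_add' P Q := by
    rw [← intervalIntegral.integral_add]
    · simp only [eval_add, add_mul]
    all_goals
      refine IntervalIntegrable.continuousOn_mul (f := fun θ => (w θ : ℂ)) hw.complex_ofReal ?_
      fun_prop
  map_smul' c P := by
    simp only [eval_smul, smul_eq_mul, RingHom.id_apply]
    rw [← intervalIntegral.integral_const_mul]
    simp only [mul_assoc]

variable {w : ℝ → ℝ} {hw : IntervalIntegrable w volume 0 (2 * Real.pi)}

lemma circlePairing_apply (k : ℕ) (P : ℂ[X]) :
    circlePairing w hw k P = ∫ θ in (0:ℝ)..(2*Real.pi),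
      P.eval (Complex.exp ((θ:ℂ) * Complex.I)) *
          Complex.exp (-(k : ℂ) * (θ:ℂ) * Complex.I) * (w θ : ℂ) := rfl

lemma circlePairing_C_mul (k : ℕ) (c : ℂ) (P : ℂ[X]) :
    circlePairing w hw k (C c * P) = c * circlePairing w hw k P := by
  rw [← smul_eq_C_mul, map_smul, smul_eq_mul]

lemma circlePairing_succ_X_mul (k : ℕ) (P : ℂ[X]) :
    circlePairing w hw (k + 1) (X * P) = circlePairing w hw k P := by
  simp only [circlePairing_apply, eval_mul, eval_X]
  congr 1
  ext θ
  have : Complex.exp (-(k : ℂ) * (θ:ℂ) * Complex.I) = Complex.exp ((θ:ℂ) * Complex.I) *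
      Complex.exp (-((k + 1 : ℕ) : ℂ) * (θ:ℂ) * Complex.I) := by
    rw [← Complex.exp_add]
    congr 1
    push_cast
    ring
  rw [this]
  ring

lemma conj_exp_real_mul_I (θ : ℝ) : (starRingEnd ℂ) (Complex.exp ((θ:ℂ) * Complex.I)) =
    (Complex.exp ((θ:ℂ) * Complex.I))⁻¹ := by
  rw [← Complex.exp_conj, ← Complex.exp_neg]
  simp

/-- Evaluation of the reversed polynomial on the unit circle. -/
lemma eval_reverse_map_conj (P : ℂ[X]) (θ : ℝ) :
    ((P.map (starRingEnd ℂ)).reverse).eval (Complex.exp ((θ:ℂ) * Complex.I)) =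
      Complex.exp ((θ:ℂ) * Complex.I) ^ P.natDegree *
        (starRingEnd ℂ) (P.eval (Complex.exp ((θ:ℂ) * Complex.I))) := by
  have hz := Complex.exp_ne_zero ((θ:ℂ) * Complex.I)
  let : Invertible (Complex.exp ((θ:ℂ) * Complex.I))⁻¹ := invertibleOfNonzero (inv_ne_zero hz)
  have h := eval₂_reverse_mul_pow (RingHom.id ℂ) (Complex.exp ((θ:ℂ) * Complex.I))⁻¹
    (P.map (starRingEnd ℂ))
  have h2 : (starRingEnd ℂ) (P.eval (Complex.exp ((θ:ℂ) * Complex.I))) =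
      (P.map (starRingEnd ℂ)).eval (Complex.exp ((θ:ℂ) * Complex.I))⁻¹ := by
    rw [eval_map, ← conj_exp_real_mul_I, eval₂_hom]
  rw [h2, ← eval₂_id, ← eval₂_id (p := P.map (starRingEnd ℂ)), ← h]
  rw [invOf_eq_inv, inv_inv, natDegree_map, inv_pow]
  field_simp

lemma circlePairing_reverse_map_conj {k : ℕ} {P : ℂ[X]} (hk : k ≤ P.natDegree) :
    circlePairing w hw k (P.map (starRingEnd ℂ)).reverse =
      (starRingEnd ℂ) (circlePairing w hw (P.natDegree - k) P) := by
  simp only [circlePairing_apply, eval_reverse_map_conj]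
  have hle : (0:ℝ) ≤ 2 * Real.pi := by positivity
  rw [intervalIntegral.integral_of_le hle, intervalIntegral.integral_of_le hle, ← integral_conj]
  congr 1
  ext θ
  have : Complex.exp ((θ:ℂ) * Complex.I) ^ P.natDegree * Complex.exp (-(k : ℂ) * (θ:ℂ) * Complex.I)
      = (starRingEnd ℂ) (Complex.exp (-((P.natDegree - k : ℕ) : ℂ) * (θ:ℂ) * Complex.I)) := by
    rw [← Complex.exp_conj, ← Complex.exp_nat_mul, ← Complex.exp_add]
    congr 1
    push_cast [hk]
    simp
    ring
  simp only [map_mul, Complex.conj_ofReal, ← this]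
  ring

/-- A polynomial of degree less than `n` orthogonal to `1, z, …, z^{n-1}` vanishes. -/
lemma eq_zero_of_circlePairing_eq_zero (hpos : ∀ θ ∈ Set.Ioo 0 (2 * Real.pi), 0 < w θ)
    {n : ℕ} {S : ℂ[X]} (hS : ∀ m ≥ n, S.coeff m = 0)
    (h : ∀ k < n, circlePairing w hw k S = 0) : S = 0 := by
  have hpi := Real.pi_pos
  have hint : ∫ θ in (0:ℝ)..(2*Real.pi),
      ‖S.eval (Complex.exp ((θ:ℂ) * Complex.I))‖ ^ 2 * w θ = 0 := by
    have hconj (θ : ℝ) : (starRingEnd ℂ) (S.eval (Complex.exp ((θ:ℂ) * Complex.I))) =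
        ∑ k ∈ Finset.range n,
          (starRingEnd ℂ) (S.coeff k) * Complex.exp (-(k : ℂ) * (θ:ℂ) * Complex.I) := by
      rw [eval_eq_sum_range' (n := S.natDegree + 1 + n) (by omega), map_sum]
      rw [← Finset.sum_subset (Finset.range_mono (show n ≤ S.natDegree + 1 + n by omega))]
      · refine Finset.sum_congr rfl fun k _ => ?_
        rw [map_mul, map_pow, conj_exp_real_mul_I, ← Complex.exp_neg, ← Complex.exp_nat_mul]
        congr 2
        ring
      · intro k _ hk
        simp [hS k (by simpa using hk)]
    have hC : ((∫ θ in (0:ℝ)..(2*Real.pi),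
        ‖S.eval (Complex.exp ((θ:ℂ) * Complex.I))‖ ^ 2 * w θ : ℝ) : ℂ) =
        ∑ k ∈ Finset.range n, (starRingEnd ℂ) (S.coeff k) * circlePairing w hw k S := by
      rw [← intervalIntegral.integral_ofReal]
      simp only [circlePairing_apply, ← intervalIntegral.integral_const_mul]
      rw [← intervalIntegral.integral_finsetSum]
      · congr 1
        ext θ
        rw [Complex.ofReal_mul, Complex.ofReal_pow, ← Complex.mul_conj', hconj, Finset.mul_sum,
          Finset.sum_mul]
        refine Finset.sum_congr rfl fun k _ => ?_
        ring
      · intro k _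
        refine IntervalIntegrable.const_mul (IntervalIntegrable.continuousOn_mul (f := fun θ => (w θ : ℂ)) hw.complex_ofReal ?_) _
        fun_prop
    rw [Finset.sum_eq_zero (fun k hk => by rw [h k (Finset.mem_range.1 hk), mul_zero])] at hC
    exact_mod_cast hC
  have hle : (0:ℝ) ≤ 2 * Real.pi := by positivity
  rw [intervalIntegral.integral_of_le hle, MeasureTheory.integral_Ioc_eq_integral_Ioo] at hint
  rw [MeasureTheory.integral_eq_zero_iff_of_nonneg_ae] at hint
  · have hroot : Set.EqOn (fun θ : ℝ => S.eval (Complex.exp ((θ:ℂ) * Complex.I))) (fun _ => 0)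
        (Set.Ioo 0 (2 * Real.pi)) := by
      refine Measure.eqOn_open_of_ae_eq (μ := volume) ?_ isOpen_Ioo (by fun_prop) (by fun_prop)
      filter_upwards [hint, ae_restrict_mem measurableSet_Ioo] with θ h0 hθ
      simpa [(hpos θ hθ).ne'] using h0
    refine eq_zero_of_infinite_isRoot S (Set.Infinite.mono (s :=
      (fun θ : ℝ => Complex.exp ((θ:ℂ) * Complex.I)) '' Set.Ioo 0 Real.pi) ?_ ?_)
    · rintro _ ⟨θ, hθ, rfl⟩
      exact hroot ⟨hθ.1, by linarith [hθ.2]⟩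
    · refine (Set.Ioo_infinite hpi).image fun x hx y hy hxy => ?_
      have := Complex.exp_inj_of_neg_pi_lt_of_le_pi (by simp; linarith [hx.1])
        (by simp; linarith [hx.2]) (by simp; linarith [hy.1]) (by simp; linarith [hy.2]) hxy
      simpa using this
  · filter_upwards [ae_restrict_mem measurableSet_Ioo] with θ hθ
    have := (hpos θ hθ).le
    simp only [Pi.zero_apply]
    positivity
  · have : IntervalIntegrable (fun θ : ℝ =>
        ‖S.eval (Complex.exp ((θ:ℂ) * Complex.I))‖ ^ 2 * w θ) volume 0 (2 * Real.pi) :=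
      hw.continuousOn_mul (by fun_prop)
    exact ((intervalIntegrable_iff_integrableOn_Ioo_of_le hle).1 this)

/-- The weight `e^{-ηθ} (sin²(θ/2))^λ`. -/
noncomputable def expSinWeight (lam η θ : ℝ) : ℝ :=
  Real.exp (-η * θ) * (Real.sin (θ/2)^2) ^ lam

lemma sin_half_pos {θ : ℝ} (hθ : θ ∈ Set.Ioo 0 (2 * Real.pi)) : 0 < Real.sin (θ/2) :=
  Real.sin_pos_of_pos_of_lt_pi (by linarith [hθ.1]) (by linarith [hθ.2])

lemma expSinWeight_pos (lam η : ℝ) {θ : ℝ} (hθ : θ ∈ Set.Ioo 0 (2 * Real.pi)) :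
    0 < expSinWeight lam η θ := by
  have := sin_half_pos hθ
  unfold expSinWeight
  positivity

lemma hasDerivAt_sin_half_sq_rpow (p : ℝ) {θ : ℝ} (hθ : Real.sin (θ/2) ≠ 0) :
    HasDerivAt (fun θ => (Real.sin (θ/2)^2) ^ p)
      (p * (Real.cos (θ/2) / Real.sin (θ/2)) * (Real.sin (θ/2)^2) ^ p) θ := by
  have h1 : HasDerivAt (fun θ : ℝ => Real.sin (θ/2)) (Real.cos (θ/2) * (1/2)) θ :=
    ((hasDerivAt_id θ).div_const 2).sin
  have hs : Real.sin (θ/2)^2 ≠ 0 := pow_ne_zero 2 hθ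
  refine ((h1.pow 2).rpow_const (p := p) (Or.inl hs)).congr_deriv ?_
  simp only [Pi.pow_apply]
  rw [Real.rpow_sub_one hs]
  field_simp
  norm_num
  ring

lemma continuous_sin_half_sq_rpow {p : ℝ} (hp : 0 ≤ p) :
    Continuous fun θ : ℝ => (Real.sin (θ/2)^2) ^ p :=
  Continuous.rpow_const (by fun_prop) fun _ => Or.inr hp

lemma intervalIntegrable_expSinWeight {lam : ℝ} (hlam : -1/2 < lam) (η : ℝ) :
    IntervalIntegrable (expSinWeight lam η) volume 0 (2 * Real.pi) := by
  have hle : (0:ℝ) ≤ 2 * Real.pi := by positivity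
  suffices h : IntervalIntegrable (fun θ : ℝ => (Real.sin (θ/2)^2) ^ lam) volume 0
      (2 * Real.pi) from h.continuousOn_mul (by fun_prop)
  have hc1 := continuous_sin_half_sq_rpow (p := lam + 1) (by linarith)
  have hc2 := continuous_sin_half_sq_rpow (p := lam + 1/2) (by linarith)
  have key : IntervalIntegrable (fun θ : ℝ => (lam + 1/2) * (Real.sin (θ/2)^2) ^ lam) volume 0
      (2 * Real.pi) := by
    refine intervalIntegral.intervalIntegrable_deriv_of_nonneg
      (g := fun θ => Real.cos (θ/2) * (Real.sin (θ/2)^2) ^ (lam + 1/2) +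
        (lam + 1) * ∫ t in (0:ℝ)..θ, (Real.sin (t/2)^2) ^ (lam + 1)) ?_ ?_ ?_
    · refine Continuous.continuousOn ?_
      have := intervalIntegral.continuous_primitive
        (fun a b => hc1.intervalIntegrable a b) 0 (μ := volume)
      fun_prop
    · intro θ hθ
      rw [min_eq_left hle, max_eq_right hle] at hθ
      have hs := sin_half_pos hθ
      have h1 : HasDerivAt (fun θ : ℝ => Real.cos (θ/2)) (-Real.sin (θ/2) * (1/2)) θ :=
        ((hasDerivAt_id θ).div_const 2).cos
      refine ((h1.mul (hasDerivAt_sin_half_sq_rpow (lam + 1/2) hs.ne')).add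
        ((intervalIntegral.integral_hasDerivAt_right (hc1.intervalIntegrable 0 θ)
          (hc1.stronglyMeasurableAtFilter _ _) hc1.continuousAt).const_mul (lam + 1))).congr_deriv ?_
      have hs2 : 0 < Real.sin (θ/2)^2 := by positivity
      have hc : Real.cos (θ/2)^2 = 1 - Real.sin (θ/2)^2 := Real.cos_sq' _
      rw [Real.rpow_add hs2, Real.rpow_add hs2, ← Real.sqrt_eq_rpow, Real.sqrt_sq hs.le,
        Real.rpow_one]
      field_simp
      rw [hc]
      ring
    · intro θ _
      have : 0 < lam + 1/2 := by linarith
      positivity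
  have hne : lam + 1/2 ≠ 0 := by linarith
  simpa only [inv_mul_cancel_left₀ hne] using key.const_mul (lam + 1/2)⁻¹

lemma continuousOn_sin_half_mul_rpow {lam : ℝ} (hlam : -1/2 < lam) :
    ContinuousOn (fun θ : ℝ => Real.sin (θ/2) * (Real.sin (θ/2)^2) ^ lam)
      (Set.Icc 0 (2 * Real.pi)) := by
  refine (continuous_sin_half_sq_rpow (p := lam + 1/2) (by linarith)).continuousOn.congr ?_
  intro θ hθ
  have hs : 0 ≤ Real.sin (θ/2) :=
    Real.sin_nonneg_of_nonneg_of_le_pi (by linarith [hθ.1]) (by linarith [hθ.2])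
  rcases hs.eq_or_lt with h | h
  · have : lam + 1/2 ≠ 0 := by linarith
    simp only [← h]
    rw [zero_mul, zero_pow two_ne_zero, Real.zero_rpow this]
  · have hs2 : 0 < Real.sin (θ/2)^2 := by positivity
    simp only
    rw [Real.rpow_add hs2, ← Real.sqrt_eq_rpow, Real.sqrt_sq hs, mul_comm]

lemma exp_mul_I_eq_half (θ : ℝ) : Complex.exp ((θ:ℂ) * Complex.I) =
    ((Real.cos (θ/2) : ℂ) + (Real.sin (θ/2) : ℂ) * Complex.I) ^ 2 := by
  push_cast
  rw [← Complex.exp_mul_I, ← Complex.exp_nat_mul]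
  congr 1
  push_cast
  ring

lemma cos_half_sq (θ : ℝ) :
    (Real.cos (θ/2) : ℂ) ^ 2 = 1 - (Real.sin (θ/2) : ℂ) ^ 2 := by
  exact_mod_cast Real.cos_sq' (θ/2)

lemma exp_mul_I_sub_one (θ : ℝ) : Complex.exp ((θ:ℂ) * Complex.I) - 1 =
    2 * Complex.I * (Real.sin (θ/2) : ℂ) *
      ((Real.cos (θ/2) : ℂ) + (Real.sin (θ/2) : ℂ) * Complex.I) := by
  rw [exp_mul_I_eq_half]
  linear_combination cos_half_sq θ - (Real.sin (θ/2) : ℂ) ^ 2 * Complex.I_sq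

lemma exp_mul_I_add_one (θ : ℝ) : Complex.exp ((θ:ℂ) * Complex.I) + 1 =
    2 * (Real.cos (θ/2) : ℂ) *
      ((Real.cos (θ/2) : ℂ) + (Real.sin (θ/2) : ℂ) * Complex.I) := by
  rw [exp_mul_I_eq_half]
  linear_combination -cos_half_sq θ + (Real.sin (θ/2) : ℂ) ^ 2 * Complex.I_sq

/-- The Pearson-type identity satisfied by the weight. -/
lemma circlePairing_pearson {lam : ℝ} (hlam : -1/2 < lam) (η : ℝ) {b : ℂ}
    (hb : b = (lam : ℂ) + (η : ℂ) * Complex.I) (k : ℕ) (P : ℂ[X]) :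
    circlePairing (expSinWeight lam η) (intervalIntegrable_expSinWeight hlam η) k
      (X * (X - 1) * derivative P +
        (C (b + 1 - k) * X + C ((starRingEnd ℂ) b + k)) * P) = 0 := by
  have hle : (0:ℝ) ≤ 2 * Real.pi := by positivity
  have hI := Complex.I_ne_zero
  have hint := intervalIntegrable_expSinWeight hlam η
  refine (mul_eq_zero.1 ?_).resolve_left hI
  rw [circlePairing_apply, ← intervalIntegral.integral_const_mul]
  rw [intervalIntegral.integral_eq_sub_of_hasDerivAt_of_le
    (f := fun θ : ℝ => P.eval (Complex.exp ((θ:ℂ) * Complex.I)) *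
      Complex.exp (-(k : ℂ) * (θ:ℂ) * Complex.I) * ((Complex.exp ((θ:ℂ) * Complex.I) - 1) *
        (expSinWeight lam η θ : ℂ))) hle]
  · have h : Complex.exp (((2 * Real.pi : ℝ) : ℂ) * Complex.I) = 1 := by
      push_cast
      exact Complex.exp_two_pi_mul_I
    simp only [h]
    simp
  · refine ContinuousOn.mul (by fun_prop) ?_
    have : ContinuousOn (fun θ : ℝ => 2 * Complex.I *
        ((Real.cos (θ/2) : ℂ) + (Real.sin (θ/2) : ℂ) * Complex.I) * (Real.exp (-η * θ) : ℂ) *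
          ((Real.sin (θ/2) * (Real.sin (θ/2)^2) ^ lam : ℝ) : ℂ)) (Set.Icc 0 (2 * Real.pi)) :=
      ContinuousOn.mul (by fun_prop)
        (Complex.continuous_ofReal.comp_continuousOn (continuousOn_sin_half_mul_rpow hlam))
    refine this.congr fun θ _ => ?_
    simp only [exp_mul_I_sub_one, expSinWeight, Complex.ofReal_mul]
    ring
  · intro θ hθ
    have hs := sin_half_pos hθ
    have hsC : (Real.sin (θ/2) : ℂ) ≠ 0 := Complex.ofReal_ne_zero.2 hs.ne'
    have he : HasDerivAt (fun θ : ℝ => Complex.exp ((θ:ℂ) * Complex.I))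
        (Complex.exp ((θ:ℂ) * Complex.I) * Complex.I) θ := by
      simpa using ((Complex.ofRealCLM.hasDerivAt (x := θ)).mul_const Complex.I).cexp
    have hk : HasDerivAt (fun θ : ℝ => Complex.exp (-(k : ℂ) * (θ:ℂ) * Complex.I))
        (Complex.exp (-(k : ℂ) * (θ:ℂ) * Complex.I) * (-(k : ℂ) * Complex.I)) θ := by
      simpa using
        (((Complex.ofRealCLM.hasDerivAt (x := θ)).const_mul (-(k:ℂ))).mul_const Complex.I).cexp
    have hP := (P.hasDerivAt (Complex.exp ((θ:ℂ) * Complex.I))).comp θ he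
    have hwt : HasDerivAt (expSinWeight lam η)
        ((-η + lam * (Real.cos (θ/2) / Real.sin (θ/2))) * expSinWeight lam η θ) θ := by
      refine ((((hasDerivAt_id θ).const_mul (-η)).exp).mul
        (hasDerivAt_sin_half_sq_rpow lam hs.ne')).congr_deriv ?_
      simp only [expSinWeight, id]
      ring
    refine ((hP.mul hk).mul ((he.sub_const 1).mul hwt.ofReal_comp)).congr_deriv ?_
    have hcot : (Complex.exp ((θ:ℂ) * Complex.I) - 1) *
        ((Real.cos (θ/2) : ℂ) / (Real.sin (θ/2) : ℂ)) =
          Complex.I * (Complex.exp ((θ:ℂ) * Complex.I) + 1) := by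
      rw [exp_mul_I_sub_one, exp_mul_I_add_one]
      field_simp
    simp only [hb, eval_add, eval_sub, eval_mul, eval_X, eval_C, eval_one, map_add, map_mul,
      Complex.conj_ofReal, Complex.conj_I, Complex.ofReal_mul, Complex.ofReal_add,
      Complex.ofReal_neg, Complex.ofReal_div, Pi.mul_apply, Function.comp_apply]
    generalize (Real.cos (θ/2) : ℂ) / (Real.sin (θ/2) : ℂ) = c at *
    generalize Complex.exp ((θ:ℂ) * Complex.I) = e at *
    generalize Complex.exp (-(k : ℂ) * (θ:ℂ) * Complex.I) = f at *
    generalize (expSinWeight lam η θ : ℂ) = v at *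
    linear_combination eval e P * f * v * lam * hcot -
      eval e P * f * v * η * (e - 1) * Complex.I_sq
  · refine IntervalIntegrable.const_mul (IntervalIntegrable.continuousOn_mul
      (f := fun θ => (expSinWeight lam η θ : ℂ)) hint.complex_ofReal ?_) _
    fun_prop

/-- First differential relation, for a polynomial orthogonal to lower powers. -/
lemma X_mul_X_sub_one_mul_derivative {lam : ℝ} (hlam : -1/2 < lam) (η : ℝ) {b : ℂ}
    (hb : b = (lam : ℂ) + (η : ℂ) * Complex.I) {n : ℕ} {P : ℂ[X]}
    (hmonic : P.Monic) (hdeg : P.natDegree = n)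
    (horth : ∀ k < n, circlePairing (expSinWeight lam η)
      (intervalIntegrable_expSinWeight hlam η) k P = 0) :
    X * (X - 1) * derivative P =
      (C (n:ℂ) * X - C ((starRingEnd ℂ) b + (n:ℂ))) * P +
        C (((starRingEnd ℂ) b + n) * P.coeff 0) * (P.map (starRingEnd ℂ)).reverse := by
  have hrev (k : ℕ) (hk : k < n) : circlePairing (expSinWeight lam η)
      (intervalIntegrable_expSinWeight hlam η) (k + 1) (P.map (starRingEnd ℂ)).reverse = 0 := by
    rw [circlePairing_reverse_map_conj (by omega), horth _ (by omega), map_zero]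
  have hlead : (P.map (starRingEnd ℂ)).reverse.coeff 0 = 1 := by
    rw [coeff_zero_reverse, (hmonic.map _).leadingCoeff]
  have hrdeg : (P.map (starRingEnd ℂ)).reverse.natDegree ≤ n :=
    (reverse_natDegree_le _).trans (by rw [natDegree_map, hdeg])
  generalize (P.map (starRingEnd ℂ)).reverse = Q at *
  rw [← sub_eq_zero]
  set R := X * (X - 1) * derivative P - ((C (n:ℂ) * X - C ((starRingEnd ℂ) b + (n:ℂ))) * P +
        C (((starRingEnd ℂ) b + n) * P.coeff 0) * Q) with hR
  have hR0 : R.coeff 0 = 0 := by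
    simp [hR, mul_coeff_zero, hlead]
    ring
  have hRX : R = X * R.divX := by
    conv_lhs => rw [← X_mul_divX_add R, hR0, C_0, add_zero]
  have hpair (k : ℕ) (hk : k < n) : circlePairing (expSinWeight lam η)
      (intervalIntegrable_expSinWeight hlam η) (k + 1) R = 0 := by
    have hdecomp : R = (X * (X - 1) * derivative P +
          (C (b + 1 - (k + 1 : ℕ)) * X + C ((starRingEnd ℂ) b + (k + 1 : ℕ))) * P) -
        C (b - k + n) * (X * P) + C ((n : ℂ) - (k + 1 : ℕ)) * P -
          C (((starRingEnd ℂ) b + n) * P.coeff 0) * Q := by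
      simp only [hR, map_add, map_sub, map_mul, C_1, Nat.cast_add, Nat.cast_one]
      ring
    rw [hdecomp]
    simp only [map_sub (circlePairing _ _ _), map_add (circlePairing _ _ _),
      circlePairing_C_mul, circlePairing_succ_X_mul]
    rw [← map_add, circlePairing_pearson hlam η hb, horth k hk, hrev k hk]
    rcases (Nat.succ_le_of_lt hk).eq_or_lt with h | h
    · simp [← h]
    · simp [horth _ h]
  have hdivX : R.divX = 0 := by
    refine eq_zero_of_circlePairing_eq_zero (hw := intervalIntegrable_expSinWeight hlam η)
      (fun θ hθ => expSinWeight_pos lam η hθ) (n := n) (fun m hm => ?_) fun k hk => ?_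
    · have hexp : R = X * (X * derivative P - C (n:ℂ) * P) - X * derivative P +
          C ((starRingEnd ℂ) b + (n:ℂ)) * P - C (((starRingEnd ℂ) b + n) * P.coeff 0) * Q := by
        rw [hR]
        ring
      have hXD (j : ℕ) : (X * derivative P).coeff j = j * P.coeff j := by
        cases j with
        | zero => simp
        | succ j => rw [coeff_X_mul, coeff_derivative]; push_cast; ring
      have hP : P.coeff (m + 1) = 0 := coeff_eq_zero_of_natDegree_lt (by omega)
      have hQ : Q.coeff (m + 1) = 0 := coeff_eq_zero_of_natDegree_lt (by omega)
      rw [coeff_divX, hexp]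
      simp only [coeff_add, coeff_sub, coeff_C_mul, coeff_X_mul, hP, hQ, hXD]
      rcases hm.eq_or_lt with h | h
      · simp [h]
      · simp [coeff_eq_zero_of_natDegree_lt (hdeg ▸ h)]
    · rw [← circlePairing_succ_X_mul, ← hRX, hpair k hk]
  rw [hRX, hdivX, mul_zero]

/-- Second differential relation, for the reversal of a polynomial orthogonal to lower powers. -/
lemma one_sub_X_mul_derivative_reverse {lam : ℝ} (hlam : -1/2 < lam) (η : ℝ) {b : ℂ}
    (hb : b = (lam : ℂ) + (η : ℂ) * Complex.I) {n : ℕ} {P : ℂ[X]}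
    (hmonic : P.Monic) (hdeg : P.natDegree = n)
    (horth : ∀ k < n, circlePairing (expSinWeight lam η)
      (intervalIntegrable_expSinWeight hlam η) k P = 0) :
    (1 - X) * derivative (P.map (starRingEnd ℂ)).reverse =
      C b * (P.map (starRingEnd ℂ)).reverse -
        C ((b + n) * (starRingEnd ℂ) (P.coeff 0)) * P := by
  have hrev (k : ℕ) (hk : k < n) : circlePairing (expSinWeight lam η)
      (intervalIntegrable_expSinWeight hlam η) (k + 1) (P.map (starRingEnd ℂ)).reverse = 0 := by
    rw [circlePairing_reverse_map_conj (by omega), horth _ (by omega), map_zero]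
  have htop : (P.map (starRingEnd ℂ)).reverse.coeff n = (starRingEnd ℂ) (P.coeff 0) := by
    rw [coeff_reverse, natDegree_map, hdeg, revAt_le le_rfl, Nat.sub_self, coeff_map]
  have hrdeg : (P.map (starRingEnd ℂ)).reverse.natDegree ≤ n :=
    (reverse_natDegree_le _).trans (by rw [natDegree_map, hdeg])
  generalize (P.map (starRingEnd ℂ)).reverse = Q at *
  rw [← sub_eq_zero]
  refine eq_zero_of_circlePairing_eq_zero (hw := intervalIntegrable_expSinWeight hlam η)
    (fun θ hθ => expSinWeight_pos lam η hθ) (n := n) (fun m hm => ?_) fun k hk => ?_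
  · have hXD : (X * derivative Q).coeff m = m * Q.coeff m := by
      cases m with
      | zero => simp
      | succ j => rw [coeff_X_mul, coeff_derivative]; push_cast; ring
    have hQ : Q.coeff (m + 1) = 0 := coeff_eq_zero_of_natDegree_lt (by omega)
    simp only [sub_mul, one_mul, coeff_sub, coeff_C_mul, hXD, coeff_derivative, hQ]
    rcases hm.eq_or_lt with h | h
    · have hlead : P.coeff n = 1 := by rw [← hdeg]; exact hmonic
      rw [← h, htop, hlead]
      ring
    · simp [coeff_eq_zero_of_natDegree_lt (hdeg ▸ h),
        coeff_eq_zero_of_natDegree_lt (hrdeg.trans_lt h)]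
  · rw [← circlePairing_succ_X_mul]
    have hdecomp : X * ((1 - X) * derivative Q -
        (C b * Q - C ((b + n) * (starRingEnd ℂ) (P.coeff 0)) * P)) =
        C ((b + n) * (starRingEnd ℂ) (P.coeff 0)) * (X * P) - C (k : ℂ) * (X * Q) +
          C ((starRingEnd ℂ) b + (k + 1 : ℕ)) * Q -
        (X * (X - 1) * derivative Q +
          (C (b + 1 - (k + 1 : ℕ)) * X + C ((starRingEnd ℂ) b + (k + 1 : ℕ))) * Q) := by
      simp only [map_add, map_sub, map_mul, C_1, Nat.cast_add, Nat.cast_one]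
      ring
    rw [hdecomp, map_sub, circlePairing_pearson hlam η hb]
    simp only [map_sub (circlePairing _ _ _), map_add (circlePairing _ _ _),
      circlePairing_C_mul, circlePairing_succ_X_mul, horth k hk, hrev k hk]
    cases k with
    | zero => simp
    | succ j => simp [hrev j (by omega)]

end

theorem stmt_10
    (lam η : ℝ) (hlam : -1/2 < lam)
    (b : ℂ) (hb : b = (lam : ℂ) + (η : ℂ) * Complex.I)
    (w : ℝ → ℝ)
    (hw : ∀ θ : ℝ, w θ = Real.exp (-η * θ) * (Real.sin (θ/2)^2) ^ lam)
    (Φ : ℕ → Polynomial ℂ)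
    (hmonic : ∀ n, (Φ n).Monic)
    (hdeg : ∀ n, (Φ n).natDegree = n)
    (horth : ∀ n, ∀ k < n,
      ∫ θ in (0:ℝ)..(2*Real.pi),
        (Φ n).eval (Complex.exp ((θ:ℂ) * Complex.I)) *
          Complex.exp (-(k : ℂ) * (θ:ℂ) * Complex.I) * (w θ : ℂ) = 0)
    (α : ℕ → ℂ)
    (hα : ∀ m, α m = -(starRingEnd ℂ) ((Φ (m+1)).coeff 0))
    (Φs : ℕ → Polynomial ℂ)
    (hΦs : ∀ n, Φs n = ((Φ n).map (starRingEnd ℂ)).reverse)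
    (n : ℕ) (hn : 3 ≤ n) :
    X * (X - 1) * derivative (Φ n)
        = (C (n:ℂ) * X - C ((starRingEnd ℂ) (b) + (n:ℂ))) * Φ n
          - C (((starRingEnd ℂ) (b) + (n:ℂ)) * (starRingEnd ℂ) (α (n-1))) * Φs n
    ∧ (1 - X) * derivative (Φs n)
        = C ((b + (n:ℂ)) * α (n-1)) * Φ n + C b * Φs n := by
  obtain rfl : w = expSinWeight lam η := funext hw
  have hα' : α (n - 1) = -(starRingEnd ℂ) ((Φ n).coeff 0) := by
    rw [hα, Nat.sub_add_cancel (by omega)]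
  rw [hΦs, hα', X_mul_X_sub_one_mul_derivative hlam η hb (hmonic n) (hdeg n) (horth n),
    one_sub_X_mul_derivative_reverse hlam η hb (hmonic n) (hdeg n) (horth n)]
  simp only [map_neg, mul_neg, neg_mul, Complex.conj_conj]
  constructor <;> ring
end

section
/- Second order differential equations for the MOPUC of the weight w(θ) = e^{−ηθ}(sin²(θ/2))^λ: for every n ≥ 3, z(1−z)Φ_n''(z) + [(n−b−2)z − conj(b) − n + 1]Φ_n'(z) + n(1+b)Φ_n(z) = 0 and z(1−z)(Φ_n*)''(z) + [(n−b−1)z − (conj(b)+n)](Φ_n*)'(z) + n b Φ_n*(z) = 0, as identities of polynomials in z, where b = λ + iη. -/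
open Polynomial MeasureTheory

theorem sum_recurrence_mul_moment_eq_zero {b c : ℂ} {μ : ℤ → ℂ}
    (hμ : ∀ m : ℤ, (m + 1 + b) * μ (m + 1) = (m - c) * μ m) {n : ℕ} {a : ℕ → ℂ}
    (ha : ∀ k < n, ∑ j ∈ Finset.range (n + 1), a j * μ (j - k) = 0) (k : ℕ) (hk : k < n) :
    ∑ j ∈ Finset.range n, (((n : ℂ) - j) * (j + 1 + b) * a j
      - (j + 1) * (n - 1 - j + c) * a (j + 1)) * μ (j - k) = 0 := by
  have h1 : ∑ j ∈ Finset.range n, ((n : ℂ) - j) * (j + 1 + b) * a j * μ (j - k)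
      = ∑ j ∈ Finset.range (n + 1), ((n : ℂ) - j) * (j + 1 + b) * a j * μ (j - k) := by
    rw [Finset.sum_range_succ]; simp
  have h2 : ∑ j ∈ Finset.range n, ((j : ℂ) + 1) * (n - 1 - j + c) * a (j + 1) * μ (j - k)
      = ∑ j ∈ Finset.range (n + 1), (j : ℂ) * (n - j + c) * a j * μ (j - (k + 1)) := by
    rw [Finset.sum_range_succ']
    simp only [Nat.cast_zero, zero_mul, add_zero]
    refine Finset.sum_congr rfl fun j _ => ?_
    rw [show ((j + 1 : ℕ) : ℤ) - (k + 1) = j - k by push_cast; ring]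
    push_cast; ring
  have h3 : ∀ j : ℕ, ((n : ℂ) - j) * (j + 1 + b) * a j * μ (j - k)
      - (j : ℂ) * (n - j + c) * a j * μ (j - (k + 1))
      = (n * (1 + b) + (k + 1 - n) * (b - k)) * (a j * μ (j - k))
        + (k + 1 - n) * (k + 1 + c) * (a j * μ (j - (k + 1))) := by
    intro j
    have := hμ (j - (k + 1))
    rw [show (j : ℤ) - (k + 1) + 1 = j - k by ring] at this
    push_cast at this
    linear_combination (-(j + k + 1 - n) * a j) * this
  simp_rw [sub_mul _ _ (μ _)]
  rw [Finset.sum_sub_distrib, h1, h2, ← Finset.sum_sub_distrib, Finset.sum_congr rfl fun j _ => h3 j,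
    Finset.sum_add_distrib, ← Finset.mul_sum, ← Finset.mul_sum, ha k hk]
  rcases Nat.lt_or_ge (k + 1) n with h | h
  · have := ha (k + 1) h
    push_cast at this
    rw [this]; simp
  · have : (n : ℂ) = k + 1 := by exact_mod_cast (by omega : n = k + 1)
    simp [this]

theorem intervalIntegrable_mul_ofReal {w : ℝ → ℝ} {a b : ℝ} (hw : IntervalIntegrable w volume a b)
    {g : ℝ → ℂ} (hg : Continuous g) :
    IntervalIntegrable (fun θ => g θ * (w θ : ℂ)) volume a b :=
  IntervalIntegrable.continuousOn_mul ⟨hw.1.ofReal, hw.2.ofReal⟩ hg.continuousOn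

theorem eval_eq_sum_range_of_degree_lt {R : Type*} [Semiring R] {p : R[X]} {n : ℕ}
    (hp : p.degree < n) (x : R) : p.eval x = ∑ k ∈ Finset.range n, p.coeff k * x ^ k := by
  rcases eq_or_ne p 0 with rfl | h0
  · simp
  · exact eval_eq_sum_range' ((natDegree_lt_iff_degree_lt h0).2 hp) x

theorem sin_sq_half_rpow_eq (lam : ℝ) {θ : ℝ} (hθ : θ ∈ Set.Icc 0 (2 * Real.pi)) :
    (Real.sin (θ / 2) ^ 2) ^ lam = Real.sin (θ / 2) ^ (2 * lam) := by
  have h : 0 ≤ Real.sin (θ / 2) :=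
    Real.sin_nonneg_of_nonneg_of_le_pi (by linarith [hθ.1]) (by linarith [hθ.2])
  rw [Real.rpow_mul h]; norm_num

theorem hasDerivAt_sin_half_rpow (lam : ℝ) {θ : ℝ} (hθ : θ ∈ Set.Ioo 0 (2 * Real.pi)) :
    HasDerivAt (fun θ => Real.sin (θ / 2) ^ (2 * lam + 1))
      ((2 * lam + 1) / 2 * (Real.sin (θ / 2) ^ (2 * lam) * Real.cos (θ / 2))) θ := by
  have h : 0 < Real.sin (θ / 2) :=
    Real.sin_pos_of_pos_of_lt_pi (by linarith [hθ.1]) (by linarith [hθ.2])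
  have h1 := (((hasDerivAt_id θ).div_const 2).sin).rpow_const (p := 2 * lam + 1) (Or.inl h.ne')
  refine h1.congr_deriv ?_
  simp only [id, add_sub_cancel_right]; ring

theorem continuous_sin_half_rpow {lam : ℝ} (hlam : -1 / 2 < lam) :
    Continuous fun θ => Real.sin (θ / 2) ^ (2 * lam + 1) :=
  (by fun_prop : Continuous fun θ : ℝ => Real.sin (θ / 2)).rpow_const
    fun _ => Or.inr (by linarith)

theorem intervalIntegrable_sin_half_rpow_mul_cos {lam : ℝ} (hlam : -1 / 2 < lam) :
    IntervalIntegrable (fun θ => Real.sin (θ / 2) ^ (2 * lam) * Real.cos (θ / 2)) volume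
      0 (2 * Real.pi) := by
  have hpi := Real.pi_pos
  have hc : 0 < (2 * lam + 1) / 2 := by linarith
  have hs : ∀ θ ∈ Set.Ioo 0 (2 * Real.pi), 0 ≤ Real.sin (θ / 2) := fun θ hθ =>
    Real.sin_nonneg_of_nonneg_of_le_pi (by linarith [hθ.1]) (by linarith [hθ.2])
  have h : IntervalIntegrable (fun θ => (2 * lam + 1) / 2 *
      (Real.sin (θ / 2) ^ (2 * lam) * Real.cos (θ / 2))) volume 0 (2 * Real.pi) := by
    refine IntervalIntegrable.trans (b := Real.pi) ?_ ?_
    · refine intervalIntegral.intervalIntegrable_deriv_of_nonneg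
        (continuous_sin_half_rpow hlam).continuousOn (fun θ hθ => ?_) fun θ hθ => ?_
      all_goals rw [min_eq_left hpi.le, max_eq_right hpi.le] at hθ
      · exact hasDerivAt_sin_half_rpow lam ⟨hθ.1, by linarith [hθ.2]⟩
      · have := hs θ ⟨hθ.1, by linarith [hθ.2]⟩
        have := Real.cos_nonneg_of_neg_pi_div_two_le_of_le (x := θ / 2) (by linarith [hθ.1])
          (by linarith [hθ.2])
        positivity
    · suffices hn : IntervalIntegrable (-fun θ => (2 * lam + 1) / 2 *
          (Real.sin (θ / 2) ^ (2 * lam) * Real.cos (θ / 2))) volume Real.pi (2 * Real.pi) by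
        simpa only [neg_neg] using hn.neg
      refine intervalIntegral.intervalIntegrable_deriv_of_nonneg
        (continuous_sin_half_rpow hlam).neg.continuousOn (fun θ hθ => ?_) fun θ hθ => ?_
      all_goals rw [min_eq_left (by linarith), max_eq_right (by linarith)] at hθ
      · exact (hasDerivAt_sin_half_rpow lam ⟨by linarith [hθ.1], hθ.2⟩).neg
      · have h1 := hs θ ⟨by linarith [hθ.1], hθ.2⟩
        have h2 := Real.cos_nonpos_of_pi_div_two_le_of_le (x := θ / 2) (by linarith [hθ.1])
          (by linarith [hθ.2])
        have h3 := mul_nonneg (mul_nonneg hc.le (Real.rpow_nonneg h1 (2 * lam)))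
          (neg_nonneg.2 h2)
        simp only [Pi.neg_apply]; linarith
  have := h.const_mul ((2 * lam + 1) / 2)⁻¹
  simpa only [inv_mul_cancel_left₀ hc.ne'] using this

theorem intervalIntegrable_sin_half_rpow {lam : ℝ} (hlam : -1 / 2 < lam) :
    IntervalIntegrable (fun θ => Real.sin (θ / 2) ^ (2 * lam)) volume 0 (2 * Real.pi) := by
  have h1 := (intervalIntegrable_sin_half_rpow_mul_cos hlam).mul_continuousOn
    (g := fun θ => Real.cos (θ / 2)) (by fun_prop)
  have h2 := (((continuous_sin_half_rpow hlam).mul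
    (by fun_prop : Continuous fun θ : ℝ => Real.sin (θ / 2))).intervalIntegrable
      (μ := volume) 0 (2 * Real.pi))
  refine (h1.add h2).congr_uIoo fun θ hθ => ?_
  rw [Set.uIoo_of_le (by positivity)] at hθ
  have h : 0 < Real.sin (θ / 2) :=
    Real.sin_pos_of_pos_of_lt_pi (by linarith [hθ.1]) (by linarith [hθ.2])
  simp only [Pi.mul_apply, Real.rpow_add_one h.ne']
  linear_combination Real.sin (θ / 2) ^ (2 * lam) * Real.sin_sq_add_cos_sq (θ / 2)

theorem intervalIntegrable_exp_mul_sin_sq_rpow {lam : ℝ} (hlam : -1 / 2 < lam) (η : ℝ) :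
    IntervalIntegrable (fun θ => Real.exp (-η * θ) * (Real.sin (θ / 2) ^ 2) ^ lam) volume
      0 (2 * Real.pi) := by
  refine ((intervalIntegrable_sin_half_rpow hlam).continuousOn_mul
    (g := fun θ => Real.exp (-η * θ)) (by fun_prop)).congr_uIoo fun θ hθ => ?_
  rw [Set.uIoo_of_le (by positivity)] at hθ
  simp only [sin_sq_half_rpow_eq lam ⟨hθ.1.le, hθ.2.le⟩]

theorem moment_recurrence {lam : ℝ} (hlam : -1 / 2 < lam) (η : ℝ) (m : ℤ) :
    ((m : ℂ) + 1 + (lam + η * Complex.I)) * (∫ θ in (0 : ℝ)..(2 * Real.pi),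
        Complex.exp (((m + 1 : ℤ) : ℂ) * θ * Complex.I) *
          ((Real.exp (-η * θ) * (Real.sin (θ / 2) ^ 2) ^ lam : ℝ) : ℂ))
      = (m - (lam - η * Complex.I)) * ∫ θ in (0 : ℝ)..(2 * Real.pi),
        Complex.exp ((m : ℂ) * θ * Complex.I) *
          ((Real.exp (-η * θ) * (Real.sin (θ / 2) ^ 2) ^ lam : ℝ) : ℂ) := by
  have hint : ∀ (c : ℂ) (k : ℤ), IntervalIntegrable (fun θ : ℝ => c * (Complex.exp ((k : ℂ) * θ *
      Complex.I) * ((Real.exp (-η * θ) * (Real.sin (θ / 2) ^ 2) ^ lam : ℝ) : ℂ))) volume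
      0 (2 * Real.pi) := fun c k =>
    (intervalIntegrable_mul_ofReal (intervalIntegrable_exp_mul_sin_sq_rpow hlam η)
      (g := fun θ => Complex.exp ((k : ℂ) * θ * Complex.I)) (by fun_prop)).const_mul c
  rw [← sub_eq_zero, ← intervalIntegral.integral_const_mul, ← intervalIntegral.integral_const_mul,
    ← intervalIntegral.integral_sub (hint _ _) (hint _ _)]
  have := intervalIntegral.integral_eq_sub_of_hasDerivAt_of_le (by positivity)
    (f := fun θ : ℝ => 2 * Complex.exp ((((m : ℂ) + 1 / 2) * Complex.I - η) * θ) *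
      ((Real.sin (θ / 2) ^ (2 * lam + 1) : ℝ) : ℂ))
    (((by fun_prop : Continuous fun θ : ℝ =>
      2 * Complex.exp ((((m : ℂ) + 1 / 2) * Complex.I - η) * θ)).mul
        (Complex.continuous_ofReal.comp (continuous_sin_half_rpow hlam))).continuousOn)
    (fun θ hθ => ?_) ((hint ((m : ℂ) + 1 + (lam + η * Complex.I)) (m + 1)).sub
      (hint (m - (lam - η * Complex.I)) m))
  · rw [this]
    have h0 : (2 * lam + 1) ≠ 0 := by linarith
    simp [Real.zero_rpow h0, mul_div_cancel_left₀]
  · have h : 0 < Real.sin (θ / 2) :=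
      Real.sin_pos_of_pos_of_lt_pi (by linarith [hθ.1]) (by linarith [hθ.2])
    have he : HasDerivAt (fun θ : ℝ => 2 * Complex.exp ((((m : ℂ) + 1 / 2) * Complex.I - η) * θ))
        (2 * (Complex.exp ((((m : ℂ) + 1 / 2) * Complex.I - η) * θ) *
          (((m : ℂ) + 1 / 2) * Complex.I - η))) θ := by
      have := (((Complex.ofRealCLM.hasDerivAt (x := θ)).const_mul
        (((m : ℂ) + 1 / 2) * Complex.I - η)).cexp).const_mul 2
      simpa using this
    refine (he.mul (hasDerivAt_sin_half_rpow lam hθ).ofReal_comp).congr_deriv ?_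
    rw [sin_sq_half_rpow_eq lam ⟨hθ.1.le, hθ.2.le⟩, Real.rpow_add_one h.ne']
    have e1 : Complex.exp (((m + 1 : ℤ) : ℂ) * θ * Complex.I) * Complex.exp (-η * θ)
        = Complex.exp ((((m : ℂ) + 1 / 2) * Complex.I - η) * θ) *
          (Complex.cos (θ / 2) + Complex.sin (θ / 2) * Complex.I) := by
      rw [← Complex.exp_mul_I, ← Complex.exp_add, ← Complex.exp_add]
      congr 1; push_cast; ring
    have e2 : Complex.exp ((m : ℂ) * θ * Complex.I) * Complex.exp (-η * θ)
        = Complex.exp ((((m : ℂ) + 1 / 2) * Complex.I - η) * θ) *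
          (Complex.cos (θ / 2) - Complex.sin (θ / 2) * Complex.I) := by
      rw [sub_eq_add_neg (Complex.cos _), ← neg_mul, ← Complex.sin_neg, ← Complex.cos_neg,
        ← Complex.exp_mul_I, ← Complex.exp_add, ← Complex.exp_add]
      congr 1; ring
    push_cast at e1 ⊢
    rw [← mul_assoc (Complex.exp _) (Complex.exp _), ← mul_assoc (Complex.exp _) (Complex.exp _)]
    rw [e1, e2]
    ring_nf
    simp only [Complex.I_sq]
    ring

theorem eq_zero_of_forall_integral_eq_zero {w : ℝ → ℝ}
    (hwi : IntervalIntegrable w volume 0 (2 * Real.pi))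
    (hw : ∀ θ ∈ Set.Ioo 0 (2 * Real.pi), 0 < w θ) (n : ℕ) (p : ℂ[X]) (hp : p.degree < n)
    (h : ∀ k < n, ∫ θ in (0 : ℝ)..(2 * Real.pi), p.eval (Complex.exp (θ * Complex.I)) *
      Complex.exp (-(k : ℂ) * θ * Complex.I) * (w θ : ℂ) = 0) : p = 0 := by
  have hpi := Real.pi_pos
  have hcont : Continuous fun θ : ℝ => p.eval (Complex.exp (θ * Complex.I)) :=
    p.continuous.comp (by fun_prop)
  have hconj : ∀ θ : ℝ, (starRingEnd ℂ) (p.eval (Complex.exp (θ * Complex.I)))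
      = ∑ k ∈ Finset.range n, (starRingEnd ℂ) (p.coeff k) *
        Complex.exp (-(k : ℂ) * θ * Complex.I) := by
    intro θ
    rw [eval_eq_sum_range_of_degree_lt hp, map_sum]
    refine Finset.sum_congr rfl fun k _ => ?_
    rw [map_mul, map_pow, ← Complex.exp_conj, ← Complex.exp_nat_mul]
    congr 2
    simp; ring
  have hI : ∫ θ in (0 : ℝ)..(2 * Real.pi),
      Complex.normSq (p.eval (Complex.exp (θ * Complex.I))) * w θ = 0 := by
    have hsum : ∑ k ∈ Finset.range n, (starRingEnd ℂ) (p.coeff k) *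
        ∫ θ in (0 : ℝ)..(2 * Real.pi), p.eval (Complex.exp (θ * Complex.I)) *
          Complex.exp (-(k : ℂ) * θ * Complex.I) * (w θ : ℂ) = 0 :=
      Finset.sum_eq_zero fun k hk => by rw [h k (Finset.mem_range.1 hk), mul_zero]
    simp_rw [← intervalIntegral.integral_const_mul] at hsum
    rw [← intervalIntegral.integral_finsetSum fun (k : ℕ) _ =>
      (intervalIntegrable_mul_ofReal hwi (g := fun θ : ℝ => p.eval (Complex.exp (θ * Complex.I)) *
        Complex.exp (-(k : ℂ) * θ * Complex.I)) (hcont.mul (by fun_prop))).const_mul _] at hsum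
    rw [← Complex.ofReal_eq_zero, ← intervalIntegral.integral_ofReal, ← hsum]
    refine intervalIntegral.integral_congr fun θ _ => ?_
    rw [Complex.ofReal_mul, ← Complex.mul_conj, hconj, Finset.mul_sum, Finset.sum_mul]
    exact Finset.sum_congr rfl fun k _ => by ring
  by_contra hp0
  refine absurd hI (ne_of_gt ?_)
  have hnn : 0 ≤ᵐ[volume.restrict (Set.Ioc 0 (2 * Real.pi))] fun θ : ℝ =>
      Complex.normSq (p.eval (Complex.exp (θ * Complex.I))) * w θ := by
    rw [← restrict_Ioo_eq_restrict_Ioc]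
    exact (ae_restrict_mem measurableSet_Ioo).mono fun θ hθ =>
      mul_nonneg (Complex.normSq_nonneg _) (hw θ hθ).le
  rw [intervalIntegral.integral_pos_iff_support_of_nonneg_ae'
    (by simpa [Set.uIoc_of_le, hpi.le] using hnn)
    (hwi.continuousOn_mul (g := fun θ : ℝ => Complex.normSq (p.eval (Complex.exp (θ * Complex.I))))
      (Complex.continuous_normSq.comp hcont).continuousOn)]
  refine ⟨by positivity, ?_⟩
  have hfin : (Set.Ioo 0 Real.pi ∩
      {θ : ℝ | p.eval (Complex.exp (θ * Complex.I)) = 0}).Finite := by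
    refine Set.Finite.of_finite_image (f := fun θ : ℝ => Complex.exp (θ * Complex.I))
      ((p.rootSet_finite ℂ).subset ?_) ?_
    · rintro _ ⟨θ, hθ, rfl⟩
      rw [mem_rootSet]
      exact ⟨hp0, by simpa using hθ.2⟩
    · intro x hx y hy hxy
      refine Real.injOn_cos (Set.Ioo_subset_Icc_self hx.1) (Set.Ioo_subset_Icc_self hy.1) ?_
      simpa only [Complex.exp_ofReal_mul_I_re] using congrArg Complex.re hxy
  have hpos : 0 < volume (Set.Ioo 0 Real.pi \ (Set.Ioo 0 Real.pi ∩
      {θ : ℝ | p.eval (Complex.exp (θ * Complex.I)) = 0})) := by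
    rw [measure_sdiff_null (hfin.measure_zero _)]
    simpa using hpi
  refine hpos.trans_le (measure_mono fun θ hθ => ?_)
  have h2 : θ < 2 * Real.pi := by linarith [hθ.1.2]
  refine ⟨?_, hθ.1.1, h2.le⟩
  exact mul_ne_zero (fun h0 => hθ.2 ⟨hθ.1, Complex.normSq_eq_zero.1 h0⟩) (hw θ ⟨hθ.1.1, h2⟩).ne'

theorem integral_eval_mul_exp {w : ℝ → ℝ} (hwi : IntervalIntegrable w volume 0 (2 * Real.pi))
    {N : ℕ} {p : ℂ[X]} (hp : p.degree < N) (k : ℕ) :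
    ∫ θ in (0 : ℝ)..(2 * Real.pi), p.eval (Complex.exp (θ * Complex.I)) *
      Complex.exp (-(k : ℂ) * θ * Complex.I) * (w θ : ℂ)
    = ∑ j ∈ Finset.range N, p.coeff j * ∫ θ in (0 : ℝ)..(2 * Real.pi),
        Complex.exp (((j - k : ℤ) : ℂ) * θ * Complex.I) * (w θ : ℂ) := by
  simp_rw [← intervalIntegral.integral_const_mul]
  rw [← intervalIntegral.integral_finsetSum fun (j : ℕ) _ =>
    (intervalIntegrable_mul_ofReal hwi
      (g := fun θ : ℝ => Complex.exp (((j - k : ℤ) : ℂ) * θ * Complex.I))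
      (by fun_prop)).const_mul _]
  refine intervalIntegral.integral_congr fun θ _ => ?_
  rw [eval_eq_sum_range_of_degree_lt hp, Finset.sum_mul, Finset.sum_mul]
  refine Finset.sum_congr rfl fun j _ => ?_
  rw [← Complex.exp_nat_mul, mul_assoc (p.coeff j), ← Complex.exp_add, mul_assoc]
  congr 3
  push_cast; ring

theorem coeff_hypergeometric_operator (A B D : ℂ) (p : ℂ[X]) (j : ℕ) :
    (X * (1 - X) * derivative (derivative p) + (C A * X - C B) * derivative p + C D * p).coeff j
      = (j + 1) * (j - B) * p.coeff (j + 1) + (D + j * A - j * (j - 1)) * p.coeff j := by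
  have h : X * (1 - X) * derivative (derivative p) + (C A * X - C B) * derivative p + C D * p
      = derivative (derivative p) * X - derivative (derivative p) * X ^ 2
        + C A * (derivative p * X) - C B * derivative p + C D * p := by ring
  rw [h]
  simp only [coeff_add, coeff_sub, coeff_C_mul]
  rcases j with _ | _ | j
  · simp [coeff_derivative]
  · simp [coeff_mul_X_pow', coeff_derivative, coeff_mul_X]; ring
  · rw [coeff_mul_X, coeff_mul_X, coeff_mul_X_pow]
    simp only [coeff_derivative]
    push_cast; ring

theorem coeff_recurrence_of_orthogonal {lam : ℝ} (hlam : -1 / 2 < lam) (η : ℝ) {n : ℕ} {p : ℂ[X]}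
    (hp : p.natDegree ≤ n) (h : ∀ k < n, ∫ θ in (0 : ℝ)..(2 * Real.pi),
      p.eval (Complex.exp (θ * Complex.I)) * Complex.exp (-(k : ℂ) * θ * Complex.I) *
        ((Real.exp (-η * θ) * (Real.sin (θ / 2) ^ 2) ^ lam : ℝ) : ℂ) = 0) (j : ℕ) :
    ((n : ℂ) - j) * (j + 1 + (lam + η * Complex.I)) * p.coeff j
      = (j + 1) * (n - 1 - j + (lam - η * Complex.I)) * p.coeff (j + 1) := by
  have hwi := intervalIntegrable_exp_mul_sin_sq_rpow hlam η
  have hp' : p.degree < (n + 1 : ℕ) :=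
    (degree_le_of_natDegree_le hp).trans_lt (by exact_mod_cast n.lt_succ_self)
  rcases lt_or_ge j n with hj | hj
  swap
  · rw [coeff_eq_zero_of_natDegree_lt (n := j + 1) (by omega)]
    rcases hj.eq_or_lt with rfl | hj
    · simp
    · rw [coeff_eq_zero_of_natDegree_lt (by omega)]; simp
  set d : ℕ → ℂ := fun j => ((n : ℂ) - j) * (j + 1 + (lam + η * Complex.I)) * p.coeff j
      - (j + 1) * (n - 1 - j + (lam - η * Complex.I)) * p.coeff (j + 1) with hd
  set q : ℂ[X] := ∑ j ∈ Finset.range n, C (d j) * X ^ j with hq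
  have hqc : ∀ i < n, q.coeff i = d i := fun i hi => by
    simp [hq, finsetSum_coeff, coeff_X_pow, hi]
  have hqd : q.degree < n := by
    rw [hq, Finset.sum_range]; exact degree_sum_fin_lt fun i : Fin n => d i
  have hq0 : q = 0 := by
    refine eq_zero_of_forall_integral_eq_zero hwi (fun θ hθ => ?_) n q hqd fun k hk => ?_
    · have : 0 < Real.sin (θ / 2) :=
        Real.sin_pos_of_pos_of_lt_pi (by linarith [hθ.1]) (by linarith [hθ.2])
      positivity
    · rw [integral_eval_mul_exp hwi hqd]
      have := sum_recurrence_mul_moment_eq_zero (μ := fun m => ∫ θ in (0 : ℝ)..(2 * Real.pi),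
          Complex.exp ((m : ℂ) * θ * Complex.I) *
            ((Real.exp (-η * θ) * (Real.sin (θ / 2) ^ 2) ^ lam : ℝ) : ℂ))
        (moment_recurrence hlam η) (n := n) (a := p.coeff)
        (fun k hk => by rw [← h k hk, integral_eval_mul_exp hwi hp']) k hk
      rw [← this]
      exact Finset.sum_congr rfl fun i hi => by rw [hqc i (Finset.mem_range.1 hi)]
  have := hqc j hj
  rw [hq0, coeff_zero] at this
  exact sub_eq_zero.1 this.symm

theorem stmt_11
    (lam η : ℝ) (hlam : -1/2 < lam)
    (b : ℂ) (hb : b = (lam : ℂ) + (η : ℂ) * Complex.I)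
    (w : ℝ → ℝ)
    (hw : ∀ θ : ℝ, w θ = Real.exp (-η * θ) * (Real.sin (θ/2)^2) ^ lam)
    (Φ : ℕ → Polynomial ℂ)
    (hmonic : ∀ n, (Φ n).Monic)
    (hdeg : ∀ n, (Φ n).natDegree = n)
    (horth : ∀ n, ∀ k < n,
      ∫ θ in (0:ℝ)..(2*Real.pi),
        (Φ n).eval (Complex.exp ((θ:ℂ) * Complex.I)) *
          Complex.exp (-(k : ℂ) * (θ:ℂ) * Complex.I) * (w θ : ℂ) = 0)
    (α : ℕ → ℂ)
    (hα : ∀ m, α m = -(starRingEnd ℂ) ((Φ (m+1)).coeff 0))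
    (Φs : ℕ → Polynomial ℂ)
    (hΦs : ∀ n, Φs n = ((Φ n).map (starRingEnd ℂ)).reverse)
    (n : ℕ) (hn : 3 ≤ n) :
    X * (1 - X) * derivative (derivative (Φ n))
        + (C ((n:ℂ) - b - 2) * X - C ((starRingEnd ℂ) (b) + (n:ℂ) - 1)) * derivative (Φ n)
        + C ((n:ℂ) * (1 + b)) * Φ n = 0
    ∧ X * (1 - X) * derivative (derivative (Φs n))
        + (C ((n:ℂ) - b - 1) * X - C ((starRingEnd ℂ) (b) + (n:ℂ))) * derivative (Φs n)
        + C ((n:ℂ) * b) * Φs n = 0 := by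
  obtain rfl := funext hw
  have hbc : (starRingEnd ℂ) b = lam - η * Complex.I := by
    rw [hb]; simp [sub_eq_add_neg]
  have hrec := coeff_recurrence_of_orthogonal hlam η (hdeg n).le (horth n)
  rw [← hb, ← hbc] at hrec
  constructor
  · ext j
    rw [coeff_hypergeometric_operator, coeff_zero]
    linear_combination hrec j
  · have hs : ∀ i ≤ n, (Φs n).coeff i = (starRingEnd ℂ) ((Φ n).coeff (n - i)) := fun i hi => by
      rw [hΦs, coeff_reverse, natDegree_map, hdeg, coeff_map, revAt_le hi]
    have hs0 : ∀ i, n < i → (Φs n).coeff i = 0 := fun i hi => by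
      refine coeff_eq_zero_of_natDegree_lt (lt_of_le_of_lt ?_ hi)
      rw [hΦs]
      exact (reverse_natDegree_le _).trans (by rw [natDegree_map, hdeg])
    ext i
    rw [coeff_hypergeometric_operator, coeff_zero]
    rcases lt_trichotomy i n with hi | rfl | hi
    · obtain ⟨j, rfl⟩ : ∃ j, n = i + j + 1 := ⟨n - i - 1, by omega⟩
      rw [hs i (by omega), hs (i + 1) (by omega), show i + j + 1 - i = j + 1 by omega,
        show i + j + 1 - (i + 1) = j by omega]
      have := congrArg (starRingEnd ℂ) (hrec j)
      simp only [map_mul, map_add, map_sub, map_one, map_natCast, Complex.conj_conj] at this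
      push_cast at this ⊢
      linear_combination -this
    · rw [hs0 (i + 1) (by omega)]; ring
    · rw [hs0 i hi, hs0 (i + 1) (by omega)]; ring
end
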